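/- arXiv:1912.11086 — 5 statements merged into one kernel-verified Lean document; each statement's English description precedes it below -/
import Mathlib

section
/- Let Ω ⊆ ℝ^d be a bounded Lipschitz domain. If y : cl(Ω) → ℝ^d is continuous and the restriction of y to Ω is injective, then the restriction of y to ∂Ω is approximately invertible on ∂Ω; that is, there exists a sequence of continuous injective maps φ_k : ∂Ω → ℝ^d converging to y|_{∂Ω} uniformly on ∂Ω. -/
open Filter

/-- The open cylinder at `p` in direction `ν` with radius/height `ε`:
`{p + x' + tν : x' ⊥ ν, |x'| < ε, |t| < ε}`. -/
def LipCylinder {d : ℕ} (p ν : EuclideanSpace ℝ (Fin d)) (ε : ℝ) :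
    Set (EuclideanSpace ℝ (Fin d)) :=
  {q | ∃ x' ∈ (ℝ ∙ ν)ᗮ, ∃ t : ℝ, ‖x'‖ < ε ∧ |t| < ε ∧ q = p + x' + t • ν}

/-- `Ω ⊆ ℝ^d` is a (strong) bounded Lipschitz domain: it is open, connected, bounded,
and near every boundary point the boundary is the graph of a Lipschitz function,
with `Ω` lying locally below the graph. -/
def IsLipschitzDomain {d : ℕ} (Ω : Set (EuclideanSpace ℝ (Fin d))) : Prop :=
  IsOpen Ω ∧ IsConnected Ω ∧ Bornology.IsBounded Ω ∧
    ∀ p ∈ frontier Ω,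
      ∃ (ε : ℝ) (ν : EuclideanSpace ℝ (Fin d))
        (g : EuclideanSpace ℝ (Fin d) → ℝ) (L : NNReal),
        0 < ε ∧ ‖ν‖ = 1 ∧ g 0 = 0 ∧
        LipschitzOnWith L g {x' | x' ∈ (ℝ ∙ ν)ᗮ ∧ ‖x'‖ < ε} ∧
        (∀ x' ∈ (ℝ ∙ ν)ᗮ, ‖x'‖ < ε → |g x'| < ε) ∧
        Ω ∩ LipCylinder p ν ε =
          {q | ∃ x' ∈ (ℝ ∙ ν)ᗮ, ∃ t : ℝ, ‖x'‖ < ε ∧ -ε < t ∧ t < g x' ∧ q = p + x' + t • ν} ∧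
        frontier Ω ∩ LipCylinder p ν ε =
          {q | ∃ x' ∈ (ℝ ∙ ν)ᗮ, ‖x'‖ < ε ∧ q = p + x' + g x' • ν}

/-- Near a boundary point of a Lipschitz domain, a fixed direction points into the domain. -/
theorem IsLipschitzDomain.exists_inward_direction {d : ℕ} {Ω : Set (EuclideanSpace ℝ (Fin d))}
    (hΩ : IsLipschitzDomain Ω) {p : EuclideanSpace ℝ (Fin d)} (hp : p ∈ frontier Ω) :
    ∃ (r : ℝ) (ν : EuclideanSpace ℝ (Fin d)), 0 < r ∧ ‖ν‖ = 1 ∧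
      ∀ z ∈ closure Ω, dist z p < 2 * r → ∀ s, 0 < s → s < r → z - s • ν ∈ Ω := by
  obtain ⟨ε, ν, g, L, hε, hν, -, -, hg, hin, hfr⟩ := hΩ.2.2.2 p hp
  refine ⟨ε / 4, ν, by positivity, hν, fun z hz hzp s hs0 hs => ?_⟩
  have below : ∀ x' ∈ (ℝ ∙ ν)ᗮ, ∀ t : ℝ, ‖x'‖ < ε → t ≤ g x' → z = p + x' + t • ν →
      z - s • ν ∈ Ω := by
    intro x' hx' t hxε ht hzeq
    have hort : inner ℝ ν x' = 0 := Submodule.mem_orthogonal_singleton_iff_inner_right.1 hx'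
    have hti : inner ℝ ν (z - p) = t := by
      rw [hzeq, add_assoc, add_sub_cancel_left, inner_add_right, hort, inner_smul_right,
        real_inner_self_eq_norm_sq, hν]
      ring
    have htabs : |t| ≤ dist z p := by
      rw [← hti, dist_eq_norm]
      simpa [hν] using abs_real_inner_le_norm ν (z - p)
    have := neg_abs_le t
    have hmem : z - s • ν ∈ Ω ∩ LipCylinder p ν ε := by
      rw [hin]
      refine ⟨x', hx', t - s, hxε, by linarith, by linarith, ?_⟩
      rw [hzeq, sub_smul]
      abel
    exact hmem.1
  have hcyl : z ∈ LipCylinder p ν ε := by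
    set t : ℝ := inner ℝ ν (z - p) with ht
    have htabs : |t| ≤ dist z p := by
      rw [dist_eq_norm]
      simpa [hν] using abs_real_inner_le_norm ν (z - p)
    refine ⟨z - p - t • ν, ?_, t, ?_, by linarith, by abel⟩
    · rw [Submodule.mem_orthogonal_singleton_iff_inner_right, inner_sub_right, inner_smul_right,
        real_inner_self_eq_norm_sq, hν, ht]
      ring
    · have h := norm_sub_le (z - p) (t • ν)
      rw [norm_smul, hν, mul_one, Real.norm_eq_abs, ← dist_eq_norm z p] at h
      linarith
  rw [closure_eq_self_union_frontier] at hz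
  rcases hz with hz | hz
  · have h : z ∈ Ω ∩ LipCylinder p ν ε := ⟨hz, hcyl⟩
    rw [hin] at h
    obtain ⟨x', hx', t, hxε, -, ht, hzeq⟩ := h
    exact below x' hx' t hxε ht.le hzeq
  · have h : z ∈ frontier Ω ∩ LipCylinder p ν ε := ⟨hz, hcyl⟩
    rw [hfr] at h
    obtain ⟨x', hx', hxε, hzeq⟩ := h
    exact below x' hx' (g x') hxε le_rfl hzeq

/-- A finite family of locally inward directions is glued by tent functions into a single bounded
Lipschitz field pointing inward on the union of the balls. -/
theorem exists_lipschitz_inward_field {E : Type*} [NormedAddCommGroup E] [NormedSpace ℝ E]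
    {Ω : Set E} (r : E → ℝ) (ν : E → E) (T : Finset E)
    (hT : ∀ p ∈ T, 0 < r p ∧ ‖ν p‖ = 1 ∧
      ∀ z ∈ closure Ω, dist z p < 2 * r p → ∀ s, 0 < s → s < r p → z - s • ν p ∈ Ω) :
    ∃ (v : E → E) (K : NNReal) (M : ℝ), LipschitzWith K v ∧ (∀ x, ‖v x‖ ≤ M) ∧
      ∀ᶠ s : ℝ in nhdsWithin 0 (Set.Ioi 0), ∀ x ∈ closure Ω, x - s • v x ∈ closure Ω ∧
        ((∃ p ∈ T, dist x p < r p) → x - s • v x ∈ Ω) := by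
  classical
  induction T using Finset.induction_on with
  | empty => exact ⟨0, 0, 0, LipschitzWith.const 0, by simp, by simp⟩
  | insert p T _ ih =>
    obtain ⟨v, K, M, hv, hM, hs⟩ := ih fun q hq => hT q (Finset.mem_insert_of_mem hq)
    obtain ⟨hr, hν, hp⟩ := hT p (Finset.mem_insert_self p T)
    have htent : LipschitzWith 1 fun x => max (r p - dist x p) 0 := by
      refine LipschitzWith.max_const (LipschitzWith.of_dist_le_mul fun x z => ?_) 0
      rw [Real.dist_eq, sub_sub_sub_cancel_left, abs_sub_comm, NNReal.coe_one, one_mul]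
      exact abs_dist_sub_le x z p
    have hfield : LipschitzWith 1 fun x => max (r p - dist x p) 0 • ν p := by
      refine LipschitzWith.of_dist_le_mul fun x z => ?_
      rw [dist_eq_norm, ← sub_smul, norm_smul, hν, mul_one, ← dist_eq_norm]
      exact htent.dist_le_mul x z
    have hle : ∀ x, max (r p - dist x p) 0 ≤ r p := fun x =>
      max_le (sub_le_self _ dist_nonneg) hr.le
    refine ⟨fun x => v x + max (r p - dist x p) 0 • ν p, K + 1, M + r p, hv.add hfield,
      fun x => (norm_add_le _ _).trans (add_le_add (hM x) ?_), ?_⟩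
    · rw [norm_smul, hν, mul_one, Real.norm_of_nonneg (le_max_right _ _)]
      exact hle x
    have hsM : ∀ᶠ s : ℝ in nhdsWithin 0 (Set.Ioi 0), s * M < r p :=
      nhdsWithin_le_nhds (((continuous_mul_const M).tendsto' 0 0 (zero_mul M)).eventually_lt_const hr)
    have hs1 : ∀ᶠ s : ℝ in nhdsWithin 0 (Set.Ioi 0), s < 1 :=
      nhdsWithin_le_nhds (eventually_lt_nhds one_pos)
    filter_upwards [hs, hsM, hs1, self_mem_nhdsWithin] with s hs hsM hs1 hs0 x hx
    have hs0 : 0 < s := hs0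
    obtain ⟨hcl, hin⟩ := hs x hx
    have hsplit : x - s • (v x + max (r p - dist x p) 0 • ν p) =
        x - s • v x - (s * max (r p - dist x p) 0) • ν p := by
      rw [smul_add, smul_smul, sub_sub]
    rw [hsplit]
    by_cases hxp : dist x p < r p
    · have hpos : 0 < max (r p - dist x p) 0 := lt_max_of_lt_left (sub_pos.2 hxp)
      have hdist : dist (x - s • v x) x ≤ s * M := by
        rw [dist_eq_norm, sub_sub_cancel_left, norm_neg, norm_smul, Real.norm_of_nonneg hs0.le]
        exact mul_le_mul_of_nonneg_left (hM x) hs0.le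
      have hmem := hp _ hcl (by linarith [dist_triangle (x - s • v x) x p])
        (s * max (r p - dist x p) 0) (by positivity)
        ((mul_lt_of_lt_one_left hpos hs1).trans_le (hle x))
      exact ⟨subset_closure hmem, fun _ => hmem⟩
    · rw [max_eq_right (by linarith), mul_zero, zero_smul, sub_zero]
      refine ⟨hcl, ?_⟩
      rintro ⟨q, hq, hxq⟩
      rcases Finset.mem_insert.1 hq with rfl | hq
      · exact absurd hxq hxp
      · exact hin ⟨q, hq, hxq⟩

/-- A small perturbation of the identity by a Lipschitz field is injective. -/
theorem LipschitzWith.injective_id_sub_smul {E : Type*} [NormedAddCommGroup E] [NormedSpace ℝ E]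
    {v : E → E} {K : NNReal} (hv : LipschitzWith K v) {s : ℝ} (hs0 : 0 ≤ s) (hs : s * K < 1) :
    Function.Injective fun x => x - s • v x := by
  intro a b hab
  have hab' : a - b = s • (v a - v b) := by
    have h : a - s • v a = b - s • v b := hab
    rw [smul_sub, sub_eq_sub_iff_add_eq_add, add_comm (s • v a)]
    exact sub_eq_sub_iff_add_eq_add.1 h
  by_contra hne
  have hpos : 0 < ‖a - b‖ := norm_pos_iff.2 (sub_ne_zero.2 hne)
  have h1 : ‖a - b‖ = s * ‖v a - v b‖ := by
    conv_lhs => rw [hab', norm_smul, Real.norm_of_nonneg hs0]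
  have h2 := mul_le_mul_of_nonneg_left (hv.norm_sub_le a b) hs0
  nlinarith

/-- The boundary of a Lipschitz domain can be pushed into the domain by continuous injective maps
arbitrarily close to the identity. -/
theorem IsLipschitzDomain.exists_inward_perturbation {d : ℕ}
    {Ω : Set (EuclideanSpace ℝ (Fin d))} (hΩ : IsLipschitzDomain Ω) {δ : ℝ} (hδ : 0 < δ) :
    ∃ ψ : EuclideanSpace ℝ (Fin d) → EuclideanSpace ℝ (Fin d), Continuous ψ ∧
      Function.Injective ψ ∧ Set.MapsTo ψ (frontier Ω) Ω ∧ ∀ x, dist x (ψ x) < δ := by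
  choose! r ν hr hν hin using fun p (hp : p ∈ frontier Ω) => hΩ.exists_inward_direction hp
  have hcomp : IsCompact (frontier Ω) :=
    hΩ.2.2.1.isCompact_closure.of_isClosed_subset isClosed_frontier frontier_subset_closure
  obtain ⟨T, hT, hcover⟩ := hcomp.elim_nhds_subcover (fun p => Metric.ball p (r p))
    fun p hp => Metric.ball_mem_nhds p (hr p hp)
  obtain ⟨v, K, M, hv, hM, hs⟩ := exists_lipschitz_inward_field r ν T
    fun p hp => ⟨hr p (hT p hp), hν p (hT p hp), hin p (hT p hp)⟩
  have small : ∀ (C : ℝ) {η : ℝ}, 0 < η →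
      ∀ᶠ s : ℝ in nhdsWithin 0 (Set.Ioi 0), s * C < η := fun C _ hη =>
    nhdsWithin_le_nhds (((continuous_mul_const C).tendsto' 0 0 (zero_mul C)).eventually_lt_const hη)
  obtain ⟨s, hs, hsK, hsM, hs0⟩ :=
    (hs.and ((small K one_pos).and ((small M hδ).and self_mem_nhdsWithin))).exists
  have hs0 : 0 < s := hs0
  refine ⟨fun x => x - s • v x, continuous_id.sub (hv.continuous.const_smul s),
    hv.injective_id_sub_smul hs0.le hsK, fun x hx => ?_, fun x => ?_⟩
  · obtain ⟨p, hp, hxp⟩ := Set.mem_iUnion₂.1 (hcover hx)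
    exact (hs x (frontier_subset_closure hx)).2 ⟨p, hp, hxp⟩
  · rw [dist_eq_norm, sub_sub_cancel, norm_smul, Real.norm_of_nonneg hs0.le]
    exact (mul_le_mul_of_nonneg_left (hM x) hs0.le).trans_lt hsM

/-- If `Ω` is a bounded Lipschitz domain, `y : cl(Ω) → ℝ^d` is continuous and injective
on `Ω`, then `y|_{∂Ω}` is approximately invertible on `∂Ω`: there is a sequence of
continuous injective maps `φ k : ∂Ω → ℝ^d` converging to `y` uniformly on `∂Ω`. -/
theorem approxInvertibleOnBoundary_of_injOn {d : ℕ}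
    (Ω : Set (EuclideanSpace ℝ (Fin d))) (hΩ : IsLipschitzDomain Ω)
    (y : EuclideanSpace ℝ (Fin d) → EuclideanSpace ℝ (Fin d))
    (hyc : ContinuousOn y (closure Ω)) (hyi : Set.InjOn y Ω) :
    ∃ φ : ℕ → EuclideanSpace ℝ (Fin d) → EuclideanSpace ℝ (Fin d),
      (∀ k, ContinuousOn (φ k) (frontier Ω) ∧ Set.InjOn (φ k) (frontier Ω)) ∧
      TendstoUniformlyOn φ y atTop (frontier Ω) := by
  have huc := hΩ.2.2.1.isCompact_closure.uniformContinuousOn_of_continuous hyc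
  have approx : ∀ n : ℕ, ∃ φ : EuclideanSpace ℝ (Fin d) → EuclideanSpace ℝ (Fin d),
      ContinuousOn φ (frontier Ω) ∧ Set.InjOn φ (frontier Ω) ∧
      ∀ x ∈ frontier Ω, dist (y x) (φ x) < 1 / ((n : ℝ) + 1) := by
    intro n
    obtain ⟨δ, hδ, hyδ⟩ := Metric.uniformContinuousOn_iff.1 huc _ (Nat.one_div_pos_of_nat (n := n))
    obtain ⟨ψ, hψc, hψi, hψm, hψd⟩ := hΩ.exists_inward_perturbation hδ
    exact ⟨y ∘ ψ, (hyc.mono subset_closure).comp hψc.continuousOn hψm,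
      hyi.comp hψi.injOn hψm, fun x hx =>
        hyδ x (frontier_subset_closure hx) (ψ x) (subset_closure (hψm hx)) (hψd x)⟩
  choose φ hφc hφi hφd using approx
  refine ⟨φ, fun k => ⟨hφc k, hφi k⟩, Metric.tendstoUniformlyOn_iff.2 fun ε hε => ?_⟩
  filter_upwards [tendsto_one_div_add_atTop_nhds_zero_nat.eventually_lt_const hε] with n hn x hx
  exact (hφd n x hx).trans hn
end

section
/- Let Ω ⊆ ℝ^d be open, let y : Ω → ℝ^d be continuous, let z ∈ ℝ^d, and let C be a connected component of the level set y⁻¹({z}) such that C is compact and C ⊆ Ω. Then for every ε > 0 there exists an open set A ⊆ ℝ^d such that C ⊆ A, every point of A is at distance less than ε from C, the closure of A is compact and contained in Ω, and y(x) ≠ z for every x ∈ ∂A (i.e., z ∉ y(∂A)). -/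
/-- In a compact Hausdorff space, every open neighbourhood of a connected component contains a
clopen neighbourhood of any given point of that component. -/
theorem exists_isClopen_of_connectedComponent_subset {X : Type*} [TopologicalSpace X]
    [T2Space X] [CompactSpace X] {x : X} {U : Set X} (hU : IsOpen U)
    (h : connectedComponent x ⊆ U) : ∃ Z : Set X, IsClopen Z ∧ x ∈ Z ∧ Z ⊆ U := by
  rw [connectedComponent_eq_iInter_isClopen] at h
  have : Nonempty { s : Set X // IsClopen s ∧ x ∈ s } :=
    ⟨⟨Set.univ, isClopen_univ, Set.mem_univ x⟩⟩
  obtain ⟨⟨Z, hZ, hxZ⟩, hZU⟩ := exists_subset_nhds_of_compactSpace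
    (V := fun s : { s : Set X // IsClopen s ∧ x ∈ s } => s.1)
    (fun s t => ⟨⟨s.1 ∩ t.1, s.2.1.inter t.2.1, s.2.2, t.2.2⟩,
      Set.inter_subset_left, Set.inter_subset_right⟩)
    (fun s => s.2.1.1) (fun y hy => hU.mem_nhds (h hy))
  exact ⟨Z, hZ, hxZ, hZU⟩

/-- In a locally compact Hausdorff space, let `F` be a set whose intersection
with every closed subset of an open set `W` is closed. Inside `W`, a compact
connected component of `F` has an open neighbourhood with compact closure contained in `W` whose
frontier avoids `F`. -/
theorem exists_isOpen_frontier_disjoint_of_isCompact_connectedComponentIn {X : Type*}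
    [TopologicalSpace X] [T2Space X] [LocallyCompactSpace X] {F W : Set X} {x : X} (hx : x ∈ F)
    (hF : ∀ L : Set X, IsClosed L → L ⊆ W → IsClosed (L ∩ F)) (hW : IsOpen W)
    (hC : IsCompact (connectedComponentIn F x)) (hCW : connectedComponentIn F x ⊆ W) :
    ∃ A : Set X, IsOpen A ∧ connectedComponentIn F x ⊆ A ∧ IsCompact (closure A) ∧
      closure A ⊆ W ∧ Disjoint (frontier A) F := by
  obtain ⟨L, hL, hCL, hLW⟩ := exists_compact_between hC hW hCW
  set K := L ∩ F
  have hK : IsCompact K :=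
    hL.of_isClosed_subset (hF L hL.isClosed hLW) Set.inter_subset_left
  have hCK : connectedComponentIn F x ⊆ K := fun a ha =>
    ⟨interior_subset (hCL ha), connectedComponentIn_subset F x ha⟩
  have hxK : x ∈ K := hCK (mem_connectedComponentIn hx)
  have : CompactSpace K := isCompact_iff_compactSpace.mp hK
  obtain ⟨Z, hZ, hxZ, hZL⟩ := exists_isClopen_of_connectedComponent_subset
    (x := (⟨x, hxK⟩ : K)) (isOpen_interior.preimage continuous_subtype_val : IsOpen
      ((↑) ⁻¹' interior L : Set K)) (by
    rw [← Set.image_subset_iff, ← connectedComponentIn_eq_image]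
    exact (connectedComponentIn_mono x Set.inter_subset_right).trans hCL)
  have hZc : IsCompact ((↑) '' Z : Set X) := hZ.1.isCompact.image continuous_subtype_val
  have hZc' : IsCompact ((↑) '' Zᶜ : Set X) :=
    hZ.compl.1.isCompact.image continuous_subtype_val
  obtain ⟨M, hM, hZM, hML⟩ := exists_compact_between hZc
    (isOpen_interior.sdiff hZc'.isClosed : IsOpen (interior L \ (↑) '' Zᶜ)) (by
    rintro _ ⟨a, ha, rfl⟩
    refine ⟨hZL ha, ?_⟩
    rintro ⟨b, hb, hba⟩
    exact hb (Subtype.ext hba ▸ ha))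
  have hcl : closure (interior M) ⊆ M := hM.isClosed.closure_interior_subset
  refine ⟨interior M, isOpen_interior, ?_, hM.of_isClosed_subset isClosed_closure hcl,
    fun a ha => hLW (interior_subset (hML (hcl ha)).1), ?_⟩
  · have hsub : connectedComponentIn F x ⊆ connectedComponentIn K x :=
      isPreconnected_connectedComponentIn.subset_connectedComponentIn
        (mem_connectedComponentIn hx) hCK
    refine hsub.trans (Set.Subset.trans ?_ hZM)
    rw [connectedComponentIn_eq_image hxK]
    exact Set.image_mono (hZ.connectedComponent_subset hxZ)
  · rw [Set.disjoint_left]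
    intro a ha haF
    rw [isOpen_interior.frontier_eq] at ha
    have haM := hML (hcl ha.1)
    have haK : a ∈ K := ⟨interior_subset haM.1, haF⟩
    by_cases haZ : (⟨a, haK⟩ : K) ∈ Z
    · exact ha.2 (hZM ⟨_, haZ, rfl⟩)
    · exact haM.2 ⟨_, haZ, rfl⟩


/-- If `C` is a compact connected component of the level set `y⁻¹({z})` of a continuous
map `y : Ω → ℝ^d` with `C ⊆ Ω`, then `C` can be surrounded arbitrarily closely by an
open set `A` compactly contained in `Ω` with `z ∉ y(∂A)`. -/
theorem exists_isolating_open_set {d : ℕ}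
    (Ω : Set (EuclideanSpace ℝ (Fin d))) (hΩ : IsOpen Ω)
    (y : EuclideanSpace ℝ (Fin d) → EuclideanSpace ℝ (Fin d))
    (hy : ContinuousOn y Ω)
    (z : EuclideanSpace ℝ (Fin d)) (C : Set (EuclideanSpace ℝ (Fin d)))
    (hCcomp : ∃ x₀ ∈ Ω ∩ y ⁻¹' {z}, C = connectedComponentIn (Ω ∩ y ⁻¹' {z}) x₀)
    (hCc : IsCompact C) (hCΩ : C ⊆ Ω) :
    ∀ ε > 0, ∃ A : Set (EuclideanSpace ℝ (Fin d)),
      IsOpen A ∧ C ⊆ A ∧ (∀ a ∈ A, Metric.infDist a C < ε) ∧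
      IsCompact (closure A) ∧ closure A ⊆ Ω ∧
      ∀ x ∈ frontier A, y x ≠ z := by
  obtain ⟨x₀, hx₀, rfl⟩ := hCcomp
  intro ε hε
  set C := connectedComponentIn (Ω ∩ y ⁻¹' {z}) x₀
  obtain ⟨A, hA, hCA, hAc, hAW, hAF⟩ :=
    exists_isOpen_frontier_disjoint_of_isCompact_connectedComponentIn
      (W := Ω ∩ Metric.thickening ε C) hx₀
      (fun L hL hLW => by
        rw [← Set.inter_assoc, Set.inter_eq_left.mpr (hLW.trans Set.inter_subset_left)]
        exact (hy.mono (hLW.trans Set.inter_subset_left)).preimage_isClosed_of_isClosed hL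
          isClosed_singleton)
      (hΩ.inter Metric.isOpen_thickening) hCc
      (Set.subset_inter hCΩ (Metric.self_subset_thickening hε C))
  have hne : C.Nonempty := ⟨x₀, mem_connectedComponentIn hx₀⟩
  refine ⟨A, hA, hCA, fun a ha => ?_, hAc, hAW.trans Set.inter_subset_left, fun x hx hxz => ?_⟩
  · obtain ⟨c, hc, hac⟩ := Metric.mem_thickening_iff.mp (hAW (subset_closure ha)).2
    exact (Metric.infDist_le_dist_of_mem hc).trans_lt hac
  · exact Set.disjoint_left.mp hAF hx ⟨(hAW (frontier_subset_closure hx)).1, hxz⟩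
end

section
/- Let Ω ⊆ ℝ^d be open, let y : Ω → ℝ^d be continuous and let U ⊆ Ω be open. Then the topologically reduced domain ℛ_y(U) is an open subset of U and coincides with the union, taken over all z ∈ ℝ^d, of those connected components C of y⁻¹({z}) ∩ U whose closure is compact and contained in U. -/
/-- The topologically reduced domain `ℛ_y(U)`: points `x ∈ U` admitting an open set `A`
with `x ∈ A ⊆ U`, `cl(A)` compact and contained in `Ω`, and `y(x) ∉ y(∂A)`. -/
def reducedDomain {d : ℕ}
    (y : EuclideanSpace ℝ (Fin d) → EuclideanSpace ℝ (Fin d))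
    (Ω U : Set (EuclideanSpace ℝ (Fin d))) : Set (EuclideanSpace ℝ (Fin d)) :=
  {x | x ∈ U ∧ ∃ A : Set (EuclideanSpace ℝ (Fin d)),
    IsOpen A ∧ x ∈ A ∧ A ⊆ U ∧ IsCompact (closure A) ∧ closure A ⊆ Ω ∧
    y x ∉ y '' (frontier A)}

open Set Topology in
/-- In a compact set `K`, every neighbourhood `V` of a connected component contains a relatively
compact open neighbourhood of that component whose frontier misses `K`. -/
theorem IsCompact.exists_isOpen_disjoint_frontier_of_connectedComponentIn_subset
    {X : Type*} [TopologicalSpace X] [T2Space X] [LocallyCompactSpace X]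
    {K V : Set X} (hK : IsCompact K) (hV : IsOpen V) {x : X} (hx : x ∈ K)
    (hKV : connectedComponentIn K x ⊆ V) :
    ∃ A, IsOpen A ∧ x ∈ A ∧ closure A ⊆ V ∧ IsCompact (closure A) ∧
      Disjoint (frontier A) K := by
  have : CompactSpace K := isCompact_iff_compactSpace.mp hK
  let ι := {s : Set K // IsClopen s ∧ (⟨x, hx⟩ : K) ∈ s}
  have : Nonempty ι := ⟨⟨univ, isClopen_univ, mem_univ _⟩⟩
  have hdir : Directed (· ⊇ ·) (fun s : ι => (s : Set K)) := fun s t =>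
    ⟨⟨s.1 ∩ t.1, s.2.1.inter t.2.1, s.2.2, t.2.2⟩, inter_subset_left, inter_subset_right⟩
  obtain ⟨⟨Z, hZ, hxZ⟩, hZV⟩ : ∃ s : ι, (s : Set K) ⊆ (↑) ⁻¹' V := by
    refine exists_subset_nhds_of_compactSpace hdir (fun s => s.2.1.isClosed) fun p hp => ?_
    rw [← connectedComponent_eq_iInter_isClopen] at hp
    refine (hV.preimage continuous_subtype_val).mem_nhds (hKV ?_)
    rw [connectedComponentIn_eq_image hx]
    exact mem_image_of_mem _ hp
  have hZc : IsCompact ((↑) '' Z : Set X) :=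
    hZ.isClosed.isCompact.image continuous_subtype_val
  have hZc' : IsCompact ((↑) '' Zᶜ : Set X) :=
    hZ.compl.isClosed.isCompact.image continuous_subtype_val
  have hsub : ((↑) '' Z : Set X) ⊆ V \ ((↑) '' Zᶜ : Set X) := by
    rintro _ ⟨p, hp, rfl⟩
    refine ⟨hZV hp, ?_⟩
    rintro ⟨q, hq, hqp⟩
    exact hq (Subtype.ext hqp ▸ hp)
  obtain ⟨A, hA, hZA, hAV, hAc⟩ :=
    exists_open_between_and_isCompact_closure hZc (hV.sdiff hZc'.isClosed) hsub
  refine ⟨A, hA, hZA ⟨_, hxZ, rfl⟩, fun p hp => (hAV hp).1, hAc, ?_⟩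
  rw [disjoint_left]
  intro p hp hpK
  rw [hA.frontier_eq] at hp
  by_cases hpZ : (⟨p, hpK⟩ : K) ∈ Z
  · exact hp.2 (hZA ⟨_, hpZ, rfl⟩)
  · exact (hAV hp.1).2 ⟨_, hpZ, rfl⟩

open Set Topology in
theorem isOpen_reducedDomain {d : ℕ} {y : EuclideanSpace ℝ (Fin d) → EuclideanSpace ℝ (Fin d)}
    {Ω U : Set (EuclideanSpace ℝ (Fin d))} (hy : ContinuousOn y Ω) :
    IsOpen (reducedDomain y Ω U) := by
  rw [isOpen_iff_mem_nhds]
  rintro x ⟨-, A, hA, hxA, hAU, hAc, hAΩ, hyx⟩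
  have hclosed : IsClosed (y '' frontier A) :=
    ((hAc.of_isClosed_subset isClosed_frontier frontier_subset_closure).image_of_continuousOn
      (hy.mono (frontier_subset_closure.trans hAΩ))).isClosed
  have hcont : ContinuousAt y x :=
    (hy.mono (subset_closure.trans hAΩ)).continuousAt (hA.mem_nhds hxA)
  filter_upwards [hA.mem_nhds hxA, hcont (hclosed.isOpen_compl.mem_nhds hyx)] with p hp hyp
  exact ⟨hAU hp, A, hA, hp, hAU, hAc, hAΩ, hyp⟩

open Set Topology in
/-- The fibre component through a point of the reduced domain is relatively compact in `U`. -/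
theorem closure_connectedComponentIn_of_mem_reducedDomain {d : ℕ}
    {y : EuclideanSpace ℝ (Fin d) → EuclideanSpace ℝ (Fin d)}
    {Ω U : Set (EuclideanSpace ℝ (Fin d))} (hy : ContinuousOn y Ω)
    {x : EuclideanSpace ℝ (Fin d)} (hx : x ∈ reducedDomain y Ω U) :
    IsCompact (closure (connectedComponentIn (U ∩ y ⁻¹' {y x}) x)) ∧
      closure (connectedComponentIn (U ∩ y ⁻¹' {y x}) x) ⊆ U := by
  obtain ⟨hxU, A, hA, hxA, hAU, hAc, hAΩ, hyx⟩ := hx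
  set C := connectedComponentIn (U ∩ y ⁻¹' {y x}) x
  have hfib : closure A ∩ y ⁻¹' {y x} ⊆ A := fun p hp => by
    by_contra hpA
    exact hyx ⟨p, hA.frontier_eq ▸ ⟨hp.1, hpA⟩, hp.2⟩
  have hCy : C ⊆ y ⁻¹' {y x} := (connectedComponentIn_subset _ _).trans inter_subset_right
  have hCA : C ⊆ A :=
    isPreconnected_connectedComponentIn.subset_of_closure_inter_subset hA
      ⟨x, mem_connectedComponentIn ⟨hxU, rfl⟩, hxA⟩
      fun p hp => hfib ⟨hp.1, hCy hp.2⟩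
  have hclosed : IsClosed (closure A ∩ y ⁻¹' {y x}) :=
    (hy.mono hAΩ).preimage_isClosed_of_isClosed isClosed_closure isClosed_singleton
  have hsub : closure C ⊆ closure A ∩ y ⁻¹' {y x} :=
    closure_minimal (fun p hp => ⟨subset_closure (hCA hp), hCy hp⟩) hclosed
  exact ⟨hAc.of_isClosed_subset isClosed_closure (closure_mono hCA),
    (hsub.trans hfib).trans hAU⟩

open Set Topology in
/-- A point whose fibre component is relatively compact in `U` lies in the reduced domain. -/
theorem mem_reducedDomain_of_closure_connectedComponentIn {d : ℕ}
    {y : EuclideanSpace ℝ (Fin d) → EuclideanSpace ℝ (Fin d)}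
    {Ω U : Set (EuclideanSpace ℝ (Fin d))} (hy : ContinuousOn y Ω)
    (hU : IsOpen U) (hUΩ : U ⊆ Ω) {x : EuclideanSpace ℝ (Fin d)} (hxU : x ∈ U)
    (hc : IsCompact (closure (connectedComponentIn (U ∩ y ⁻¹' {y x}) x)))
    (hcU : closure (connectedComponentIn (U ∩ y ⁻¹' {y x}) x) ⊆ U) :
    x ∈ reducedDomain y Ω U := by
  obtain ⟨V, hV, hCV, hVU, hVc⟩ := exists_open_between_and_isCompact_closure hc hU hcU
  have hKc : IsCompact (closure V ∩ y ⁻¹' {y x}) :=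
    hVc.of_isClosed_subset
      ((hy.mono (hVU.trans hUΩ)).preimage_isClosed_of_isClosed isClosed_closure
        isClosed_singleton) inter_subset_left
  have hxV : x ∈ V := hCV (subset_closure (mem_connectedComponentIn ⟨hxU, rfl⟩))
  obtain ⟨A, hA, hxA, hAV, hAc, hdisj⟩ :=
    hKc.exists_isOpen_disjoint_frontier_of_connectedComponentIn_subset hV
      ⟨subset_closure hxV, rfl⟩
      ((connectedComponentIn_mono x (inter_subset_inter_left _ hVU)).trans
        (subset_closure.trans hCV))
  have hAU : closure A ⊆ U := hAV.trans (subset_closure.trans hVU)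
  refine ⟨hxU, A, hA, hxA, subset_closure.trans hAU, hAc, hAU.trans hUΩ, ?_⟩
  rintro ⟨p, hp, hpx⟩
  exact disjoint_left.mp hdisj hp ⟨subset_closure (hAV (frontier_subset_closure hp)), hpx⟩

/-- For `Ω ⊆ ℝ^d` open, `y : Ω → ℝ^d` continuous, `U ⊆ Ω` open, the reduced domain
`ℛ_y(U)` is an open subset of `U` and equals the union over `z ∈ ℝ^d` of those connected
components of `y⁻¹({z}) ∩ U` whose closure is compact and contained in `U`. -/
theorem reducedDomain_isOpen_and_eq_union {d : ℕ}
    (Ω : Set (EuclideanSpace ℝ (Fin d))) (hΩ : IsOpen Ω)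
    (y : EuclideanSpace ℝ (Fin d) → EuclideanSpace ℝ (Fin d))
    (hy : ContinuousOn y Ω)
    (U : Set (EuclideanSpace ℝ (Fin d))) (hU : IsOpen U) (hUΩ : U ⊆ Ω) :
    IsOpen (reducedDomain y Ω U) ∧ reducedDomain y Ω U ⊆ U ∧
    reducedDomain y Ω U =
      ⋃ (z : EuclideanSpace ℝ (Fin d)) (x₀ : EuclideanSpace ℝ (Fin d))
        (_ : x₀ ∈ U ∧ y x₀ = z)
        (_ : IsCompact (closure (connectedComponentIn (U ∩ y ⁻¹' {z}) x₀)) ∧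
             closure (connectedComponentIn (U ∩ y ⁻¹' {z}) x₀) ⊆ U),
        connectedComponentIn (U ∩ y ⁻¹' {z}) x₀ := by
  refine ⟨isOpen_reducedDomain hy, fun x hx => hx.1, ?_⟩
  ext x
  simp only [Set.mem_iUnion, exists_prop]
  constructor
  · intro hx
    exact ⟨y x, x, ⟨hx.1, rfl⟩, closure_connectedComponentIn_of_mem_reducedDomain hy hx,
      mem_connectedComponentIn ⟨hx.1, rfl⟩⟩
  · rintro ⟨z, x₀, -, ⟨hc, hcU⟩, hx⟩
    obtain ⟨hxU, rfl⟩ : x ∈ U ∧ y x = z :=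
      connectedComponentIn_subset (U ∩ y ⁻¹' {z}) x₀ hx
    rw [connectedComponentIn_eq hx] at hc hcU
    exact mem_reducedDomain_of_closure_connectedComponentIn hy hU hUΩ hxU hc hcU
end

section
/- Let d ≥ 2 and let Ω ⊆ ℝ^d be a bounded Lipschitz domain whose boundary ∂Ω is connected. Then ℝ^d ∖ ∂Ω has exactly two connected components, namely Ω and ℝ^d ∖ cl(Ω); in particular Ω is the unique bounded connected component of ℝ^d ∖ ∂Ω. -/
/-- An open set with preconnected frontier is preconnected as soon as it is locally preconnected
near each of its frontier points. -/
theorem IsOpen.isPreconnected_of_frontier {X : Type*} [TopologicalSpace X] [PreconnectedSpace X]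
    [LocallyConnectedSpace X] {E : Set X} (hE : IsOpen E) (hF : IsPreconnected (frontier E))
    (hloc : ∀ p ∈ frontier E, ∃ N, IsOpen N ∧ p ∈ N ∧ IsPreconnected (N ∩ E)) :
    IsPreconnected E := by
  rcases (frontier E).eq_empty_or_nonempty with hemp | ⟨p, hp⟩
  · rcases isClopen_iff.1 (isClopen_iff_frontier_eq_empty.2 hemp) with h | h
    · rw [h]; exact isPreconnected_empty
    · rw [h]; exact isPreconnected_univ
  have hsub : ∀ {N : Set X} {q x : X}, IsOpen N → q ∈ N → IsPreconnected (N ∩ E) →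
      q ∈ closure (connectedComponentIn E x) → N ∩ E ⊆ connectedComponentIn E x := by
    intro N q x hN hqN hNE hq
    obtain ⟨z, hzN, hzU⟩ := mem_closure_iff.1 hq N hN hqN
    rw [connectedComponentIn_eq hzU]
    exact hNE.subset_connectedComponentIn ⟨hzN, connectedComponentIn_subset E x hzU⟩
      Set.inter_subset_right
  have hcl : ∀ x ∈ E, p ∈ closure (connectedComponentIn E x) := by
    intro x hx
    set U := connectedComponentIn E x with hU
    have hUo : IsOpen U := hE.connectedComponentIn
    have hxU : x ∈ U := mem_connectedComponentIn hx
    have hne : (frontier E ∩ closure U).Nonempty := by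
      by_contra hcon
      rw [Set.not_nonempty_iff_eq_empty] at hcon
      have hclE : closure U ⊆ E := by
        intro z hz
        by_contra hzE
        have : z ∈ frontier E := by
          rw [hE.frontier_eq]
          exact ⟨closure_mono (connectedComponentIn_subset E x) hz, hzE⟩
        exact (hcon ▸ (⟨this, hz⟩ : z ∈ frontier E ∩ closure U) : z ∈ (∅ : Set X))
      have hclU : closure U ⊆ U :=
        isPreconnected_connectedComponentIn.closure.subset_connectedComponentIn
          (subset_closure hxU) hclE
      have hclosed : IsClosed U := isClosed_of_closure_subset hclU
      have huniv : U = Set.univ := IsClopen.eq_univ ⟨hclosed, hUo⟩ ⟨x, hxU⟩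
      have hEuniv : E = Set.univ :=
        Set.eq_univ_of_univ_subset (huniv ▸ connectedComponentIn_subset E x)
      rw [hEuniv, frontier_univ] at hp
      exact hp
    by_contra hpU
    -- The frontier is covered by the open sets `W` (where `U` accumulates) and `(closure U)ᶜ`.
    let W : Set X := ⋃₀ {N | IsOpen N ∧ N ∩ E ⊆ U}
    have hWo : IsOpen W := isOpen_sUnion fun N hN => hN.1
    have hcover : frontier E ⊆ W ∪ (closure U)ᶜ := by
      intro q hq
      by_cases hqU : q ∈ closure U
      · obtain ⟨N, hN, hqN, hNE⟩ := hloc q hq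
        exact Or.inl ⟨N, ⟨hN, hsub hN hqN hNE hqU⟩, hqN⟩
      · exact Or.inr hqU
    have hWne : (frontier E ∩ W).Nonempty := by
      obtain ⟨q, hq, hqU⟩ := hne
      exact ⟨q, hq, (hcover hq).resolve_right fun h => h hqU⟩
    obtain ⟨q, hq, ⟨N, ⟨hN, hNU⟩, hqN⟩, hqU⟩ :=
      hF W (closure U)ᶜ hWo isClosed_closure.isOpen_compl hcover hWne ⟨p, hp, hpU⟩
    apply hqU
    rw [mem_closure_iff]
    intro O hO hqO
    obtain ⟨z, ⟨hzO, hzN⟩, hzE⟩ :=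
      mem_closure_iff.1 (frontier_subset_closure hq) (O ∩ N) (hO.inter hN) ⟨hqO, hqN⟩
    exact ⟨z, hzO, hNU ⟨hzN, hzE⟩⟩
  obtain ⟨N, hN, hpN, hNE⟩ := hloc p hp
  obtain ⟨z, hz⟩ := mem_closure_iff.1 (frontier_subset_closure hp) N hN hpN
  refine isPreconnected_of_forall z fun y hy =>
    ⟨connectedComponentIn E y, connectedComponentIn_subset E y,
      hsub hN hpN hNE (hcl y hy) hz, mem_connectedComponentIn hy,
      isPreconnected_connectedComponentIn⟩

theorem mem_LipCylinder_self {d : ℕ} (p ν : EuclideanSpace ℝ (Fin d)) {ε : ℝ} (hε : 0 < ε) :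
    p ∈ LipCylinder p ν ε :=
  ⟨0, Submodule.zero_mem _, 0, by simpa using hε, by simpa using hε, by simp⟩

theorem inner_add_smul_of_mem_orthogonal {d : ℕ} {ν x : EuclideanSpace ℝ (Fin d)} (hν : ‖ν‖ = 1)
    (hx : x ∈ (ℝ ∙ ν)ᗮ) (t : ℝ) : inner ℝ ν (x + t • ν) = t := by
  rw [inner_add_right, Submodule.mem_orthogonal_singleton_iff_inner_right.1 hx, inner_smul_right,
    real_inner_self_eq_norm_sq, hν]
  norm_num

theorem add_smul_eq_add_smul_of_mem_orthogonal {d : ℕ} {p ν x y : EuclideanSpace ℝ (Fin d)}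
    (hν : ‖ν‖ = 1) (hx : x ∈ (ℝ ∙ ν)ᗮ) (hy : y ∈ (ℝ ∙ ν)ᗮ) {s t : ℝ}
    (h : p + x + s • ν = p + y + t • ν) : x = y ∧ s = t := by
  rw [add_assoc, add_assoc, add_right_inj] at h
  have hst : s = t := by
    rw [← inner_add_smul_of_mem_orthogonal hν hx s, h, inner_add_smul_of_mem_orthogonal hν hy]
  subst hst
  exact ⟨add_right_cancel h, rfl⟩

theorem isOpen_LipCylinder {d : ℕ} (p : EuclideanSpace ℝ (Fin d)) {ν : EuclideanSpace ℝ (Fin d)}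
    (hν : ‖ν‖ = 1) (ε : ℝ) : IsOpen (LipCylinder p ν ε) := by
  have heq : LipCylinder p ν ε =
      {q | ‖(q - p) - inner ℝ ν (q - p) • ν‖ < ε} ∩ {q | |inner ℝ ν (q - p)| < ε} := by
    ext q
    constructor
    · rintro ⟨x, hx, t, hxε, htε, rfl⟩
      have hsub : p + x + t • ν - p = x + t • ν := by abel
      simp only [Set.mem_inter_iff, Set.mem_ofPred_eq, hsub,
        inner_add_smul_of_mem_orthogonal hν hx, add_sub_cancel_right]
      exact ⟨hxε, htε⟩
    · rintro ⟨h1, h2⟩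
      refine ⟨_, ?_, _, h1, h2, by abel⟩
      rw [Submodule.mem_orthogonal_singleton_iff_inner_right, inner_sub_right, inner_smul_right,
        real_inner_self_eq_norm_sq, hν]
      ring
  rw [heq]
  exact (isOpen_lt (by fun_prop) continuous_const).inter
    (isOpen_lt (by fun_prop) continuous_const)

/-- The part of a cylinder lying above a continuous graph is preconnected. -/
theorem isPreconnected_above_graph {d : ℕ} (p ν : EuclideanSpace ℝ (Fin d)) {ε : ℝ}
    {g : EuclideanSpace ℝ (Fin d) → ℝ}
    (hg : ContinuousOn g {x | x ∈ (ℝ ∙ ν)ᗮ ∧ ‖x‖ < ε})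
    (hgε : ∀ x ∈ (ℝ ∙ ν)ᗮ, ‖x‖ < ε → |g x| < ε) :
    IsPreconnected {q | ∃ x ∈ (ℝ ∙ ν)ᗮ, ∃ t : ℝ, ‖x‖ < ε ∧ g x < t ∧ t < ε ∧
      q = p + x + t • ν} := by
  set B : Set (EuclideanSpace ℝ (Fin d)) := {x | x ∈ (ℝ ∙ ν)ᗮ ∧ ‖x‖ < ε} with hB
  have hBc : Convex ℝ B := by
    have : B = ((ℝ ∙ ν)ᗮ : Set (EuclideanSpace ℝ (Fin d))) ∩ Metric.ball 0 ε := by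
      ext x; simp [hB]
    rw [this]
    exact (Submodule.convex _).inter (convex_ball 0 ε)
  let f : EuclideanSpace ℝ (Fin d) × ℝ → EuclideanSpace ℝ (Fin d) :=
    fun z => p + z.1 + (g z.1 + z.2 * (ε - g z.1)) • ν
  have hf : ContinuousOn f (B ×ˢ Set.Ioo (0 : ℝ) 1) := by
    have hg1 : ContinuousOn (fun z : EuclideanSpace ℝ (Fin d) × ℝ => g z.1)
        (B ×ˢ Set.Ioo (0 : ℝ) 1) := hg.comp continuousOn_fst fun z hz => hz.1
    exact (continuousOn_const.add continuousOn_fst).add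
      ((hg1.add (continuousOn_snd.mul (continuousOn_const.sub hg1))).smul continuousOn_const)
  have himg : f '' (B ×ˢ Set.Ioo (0 : ℝ) 1) =
      {q | ∃ x ∈ (ℝ ∙ ν)ᗮ, ∃ t : ℝ, ‖x‖ < ε ∧ g x < t ∧ t < ε ∧ q = p + x + t • ν} := by
    ext q
    constructor
    · rintro ⟨⟨x, s⟩, ⟨⟨hx, hxε⟩, hs0, hs1⟩, rfl⟩
      have hgx : 0 < ε - g x := sub_pos.2 (abs_lt.1 (hgε x hx hxε)).2
      refine ⟨x, hx, _, hxε, ?_, ?_, rfl⟩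
      · have := mul_pos hs0 hgx
        simp only at this ⊢
        linarith
      · have := mul_lt_mul_of_pos_right hs1 hgx
        simp only at this ⊢
        linarith
    · rintro ⟨x, hx, t, hxε, hgt, htε, rfl⟩
      have hgx : 0 < ε - g x := sub_pos.2 (abs_lt.1 (hgε x hx hxε)).2
      refine ⟨(x, (t - g x) / (ε - g x)), ⟨⟨hx, hxε⟩, div_pos (sub_pos.2 hgt) hgx, ?_⟩, ?_⟩
      · rw [div_lt_one hgx]; linarith
      · simp only [f]
        rw [div_mul_cancel₀ _ hgx.ne', add_sub_cancel]
  rw [← himg]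
  exact (hBc.isPreconnected.prod isPreconnected_Ioo).image f hf

/-- A boundary point of a Lipschitz domain is a limit of exterior points and has an open
neighbourhood whose exterior part is preconnected. -/
theorem IsLipschitzDomain.exists_isPreconnected_exterior {d : ℕ}
    {Ω : Set (EuclideanSpace ℝ (Fin d))} (hΩ : IsLipschitzDomain Ω)
    {p : EuclideanSpace ℝ (Fin d)} (hp : p ∈ frontier Ω) :
    p ∈ closure (closure Ω)ᶜ ∧
      ∃ N, IsOpen N ∧ p ∈ N ∧ IsPreconnected (N ∩ (closure Ω)ᶜ) := by
  obtain ⟨ε, ν, g, L, hε, hν, hg0, hgL, hgε, hin, hfr⟩ := hΩ.2.2.2 p hp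
  have hnot : ∀ q, q ∈ (closure Ω)ᶜ ↔ q ∉ Ω ∧ q ∉ frontier Ω := by
    intro q
    rw [Set.mem_compl_iff, closure_eq_self_union_frontier, Set.mem_union, not_or]
  have hext : LipCylinder p ν ε ∩ (closure Ω)ᶜ =
      {q | ∃ x ∈ (ℝ ∙ ν)ᗮ, ∃ t : ℝ, ‖x‖ < ε ∧ g x < t ∧ t < ε ∧ q = p + x + t • ν} := by
    ext q
    constructor
    · rintro ⟨hqC, hq⟩
      obtain ⟨hqΩ, hqF⟩ := (hnot q).1 hq
      obtain ⟨x, hx, t, hxε, htε, hqe⟩ := id hqC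
      refine ⟨x, hx, t, hxε, ?_, (abs_lt.1 htε).2, hqe⟩
      rcases lt_trichotomy t (g x) with h | h | h
      · exact absurd (hin.ge ⟨x, hx, t, hxε, (abs_lt.1 htε).1, h, hqe⟩).1 hqΩ
      · exact absurd (hfr.ge ⟨x, hx, hxε, h ▸ hqe⟩).1 hqF
      · exact h
    · rintro ⟨x, hx, t, hxε, hgt, htε, rfl⟩
      have htε' : |t| < ε := abs_lt.2 ⟨(abs_lt.1 (hgε x hx hxε)).1.trans hgt, htε⟩
      have hqC : p + x + t • ν ∈ LipCylinder p ν ε := ⟨x, hx, t, hxε, htε', rfl⟩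
      refine ⟨hqC, (hnot _).2 ⟨fun hqΩ => ?_, fun hqF => ?_⟩⟩
      · obtain ⟨y, hy, s, -, -, hs, he⟩ := hin.le ⟨hqΩ, hqC⟩
        obtain ⟨rfl, rfl⟩ := add_smul_eq_add_smul_of_mem_orthogonal hν hx hy he
        exact lt_asymm hs hgt
      · obtain ⟨y, hy, -, he⟩ := hfr.le ⟨hqF, hqC⟩
        obtain ⟨rfl, rfl⟩ := add_smul_eq_add_smul_of_mem_orthogonal hν hx hy he
        exact lt_irrefl _ hgt
  refine ⟨?_, LipCylinder p ν ε, isOpen_LipCylinder p hν ε, mem_LipCylinder_self p ν hε, ?_⟩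
  · have htend : Filter.Tendsto (fun t : ℝ => p + t • ν) (nhdsWithin 0 (Set.Ioi 0)) (nhds p) := by
      have hc : Continuous fun t : ℝ => p + t • ν := by fun_prop
      simpa using (hc.tendsto 0).mono_left nhdsWithin_le_nhds
    refine mem_closure_of_tendsto htend ?_
    filter_upwards [Ioo_mem_nhdsGT hε] with t ht
    exact (hext.ge ⟨0, Submodule.zero_mem _, t, by simpa using hε, by simpa [hg0] using ht.1,
      ht.2, by simp⟩).2
  · rw [hext]
    exact isPreconnected_above_graph p ν hgL.continuousOn hgε

theorem IsLipschitzDomain.frontier_compl_closure {d : ℕ}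
    {Ω : Set (EuclideanSpace ℝ (Fin d))} (hΩ : IsLipschitzDomain Ω) :
    frontier (closure Ω)ᶜ = frontier Ω := by
  refine Set.Subset.antisymm ?_ fun p hp => ?_
  · rw [frontier_compl]
    exact frontier_closure_subset
  · rw [isClosed_closure.isOpen_compl.frontier_eq]
    exact ⟨(hΩ.exists_isPreconnected_exterior hp).1, fun h => h (frontier_subset_closure hp)⟩

/-- If an open preconnected set `U` and an open set `V` disjoint from it cover `S` together and
`U ⊆ S`, then `U` is the connected component in `S` of each of its points. -/
theorem connectedComponentIn_eq_of_isOpen_union {X : Type*} [TopologicalSpace X] {S U V : Set X}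
    (hU : IsOpen U) (hV : IsOpen V) (hUV : Disjoint U V) (hS : U ∪ V = S)
    (hUc : IsPreconnected U) {x : X} (hx : x ∈ U) : connectedComponentIn S x = U := by
  have hUS : U ⊆ S := hS ▸ Set.subset_union_left
  refine Set.Subset.antisymm ?_ (hUc.subset_connectedComponentIn hx hUS)
  exact isPreconnected_connectedComponentIn.subset_left_of_subset_union hU hV hUV
    (hS ▸ connectedComponentIn_subset S x) ⟨x, mem_connectedComponentIn (hUS hx), hx⟩

/-- If `Ω ⊆ ℝ^d` (`d ≥ 2`) is a bounded Lipschitz domain with connected boundary, then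
`ℝ^d ∖ ∂Ω` has exactly two connected components, namely `Ω` and `ℝ^d ∖ cl(Ω)`; in
particular `Ω` is the unique bounded component. -/
theorem lipschitzDomain_compl_frontier_two_components {d : ℕ} (hd : 2 ≤ d)
    (Ω : Set (EuclideanSpace ℝ (Fin d))) (hΩ : IsLipschitzDomain Ω)
    (hbc : IsConnected (frontier Ω)) :
    IsConnected ((closure Ω)ᶜ) ∧
    Ω ∪ (closure Ω)ᶜ = (frontier Ω)ᶜ ∧
    Ω ≠ (closure Ω)ᶜ ∧
    (∀ x ∈ Ω, connectedComponentIn ((frontier Ω)ᶜ) x = Ω) ∧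
    (∀ x ∈ (closure Ω)ᶜ, connectedComponentIn ((frontier Ω)ᶜ) x = (closure Ω)ᶜ) ∧
    (∀ x ∈ (frontier Ω)ᶜ, Bornology.IsBounded (connectedComponentIn ((frontier Ω)ᶜ) x) →
       connectedComponentIn ((frontier Ω)ᶜ) x = Ω) := by
  have hΩo : IsOpen Ω := hΩ.1
  have hEo : IsOpen (closure Ω)ᶜ := isClosed_closure.isOpen_compl
  have hdisj : Disjoint Ω (closure Ω)ᶜ :=
    Set.disjoint_compl_right_iff_subset.2 subset_closure
  have hunion : Ω ∪ (closure Ω)ᶜ = (frontier Ω)ᶜ := by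
    rw [hΩo.frontier_eq, Set.sdiff_eq, Set.compl_inter, compl_compl, Set.union_comm]
  have hEpre : IsPreconnected (closure Ω)ᶜ := by
    refine hEo.isPreconnected_of_frontier ?_ fun p hp => ?_
    · rw [hΩ.frontier_compl_closure]
      exact hbc.isPreconnected
    · rw [hΩ.frontier_compl_closure] at hp
      exact (hΩ.exists_isPreconnected_exterior hp).2
  have hEne : ((closure Ω)ᶜ).Nonempty := by
    obtain ⟨p, hp⟩ := hbc.nonempty
    exact closure_nonempty_iff.1 ⟨p, (hΩ.exists_isPreconnected_exterior hp).1⟩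
  have hcompΩ : ∀ x ∈ Ω, connectedComponentIn ((frontier Ω)ᶜ) x = Ω := fun x hx =>
    connectedComponentIn_eq_of_isOpen_union hΩo hEo hdisj hunion hΩ.2.1.isPreconnected hx
  have hcompE : ∀ x ∈ (closure Ω)ᶜ, connectedComponentIn ((frontier Ω)ᶜ) x = (closure Ω)ᶜ :=
    fun x hx => connectedComponentIn_eq_of_isOpen_union hEo hΩo hdisj.symm
      (Set.union_comm _ _ ▸ hunion) hEpre hx
  refine ⟨⟨hEne, hEpre⟩, hunion, fun h => ?_, hcompΩ, hcompE, fun x hx hb => ?_⟩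
  · obtain ⟨x, hx⟩ := hΩ.2.1.nonempty
    exact Set.disjoint_left.1 hdisj hx (h ▸ hx)
  · rcases hunion.ge hx with hx | hx
    · exact hcompΩ x hx
    · rw [hcompE x hx] at hb
      have hbu := hb.union hΩ.2.2.1.closure
      rw [Set.compl_union_self] at hbu
      have : Nonempty (Fin d) := ⟨⟨0, by omega⟩⟩
      exact absurd hbu (NormedSpace.unbounded_univ ℝ (EuclideanSpace ℝ (Fin d)))
end

section
/- Let d ≥ 2. Let Ω ⊆ ℝ^d be a bounded domain (open and connected) and suppose there is a homeomorphism γ from cl(Ω) onto the closed upper hemisphere H̄ of S^d with γ(∂Ω) = S^{d−1} (the equator). Let y : S^{d−1} → S^d be continuous and injective, and let δ : S^d → ℝ^d ∪ {∞} be a homeomorphism onto the one-point compactification of ℝ^d such that ∞ ∉ δ(y(S^{d−1})). Define ỹ : ∂Ω → ℝ^d by ỹ := δ ∘ y ∘ γ. If there exists a homeomorphism h : S^d → S^d with h(S^{d−1}) = y(S^{d−1}), then there exists a continuous injective map h̃ : cl(Ω) → ℝ^d with h̃ = ỹ on ∂Ω (so h̃ is a homeomorphic extension of ỹ). -/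
/-- `ℝ^{d+1}` modeled as `ℝ^d × ℝ` with the Euclidean (`ℓ²`) norm. -/
abbrev EucProd (d : ℕ) := WithLp 2 (EuclideanSpace ℝ (Fin d) × ℝ)

/-- The first (`ℝ^d`) coordinate of a point of `ℝ^d × ℝ`. -/
noncomputable def xpart {d : ℕ} (q : EucProd d) : EuclideanSpace ℝ (Fin d) :=
  (WithLp.equiv 2 (EuclideanSpace ℝ (Fin d) × ℝ) q).1

/-- The last (`ℝ`) coordinate of a point of `ℝ^d × ℝ`. -/
noncomputable def tpart {d : ℕ} (q : EucProd d) : ℝ :=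
  (WithLp.equiv 2 (EuclideanSpace ℝ (Fin d) × ℝ) q).2

/-- The point `(x, t) ∈ ℝ^d × ℝ`. -/
noncomputable def mkPt {d : ℕ} (x : EuclideanSpace ℝ (Fin d)) (t : ℝ) : EucProd d :=
  (WithLp.equiv 2 (EuclideanSpace ℝ (Fin d) × ℝ)).symm (x, t)

/-- The unit sphere `S^d ⊆ ℝ^d × ℝ`. -/
def sphereD (d : ℕ) : Set (EucProd d) := Metric.sphere 0 1

/-- The equator `S^{d-1} = {(x,0) : |x| = 1} ⊆ S^d`. -/
def equatorD (d : ℕ) : Set (EucProd d) := {q ∈ sphereD d | tpart q = 0}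

/-- The closed upper hemisphere `{(x,t) ∈ S^d : t ≥ 0}`. -/
def upperHemiD (d : ℕ) : Set (EucProd d) := {q ∈ sphereD d | 0 ≤ tpart q}

/-- A map into a compact set is continuous as soon as its composition with an injective
continuous map on that compact set is. -/
theorem ContinuousOn.of_comp_injOn_isCompact {X Y Z : Type*} [TopologicalSpace X]
    [TopologicalSpace Y] [TopologicalSpace Z] [T2Space Z] {K : Set Y} (hK : IsCompact K)
    {f : Y → Z} (hf : ContinuousOn f K) (hi : Set.InjOn f K) {s : Set X} {g : X → Y}
    (hg : Set.MapsTo g s K) (hfg : ContinuousOn (fun x => f (g x)) s) : ContinuousOn g s := by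
  have := isCompact_iff_compactSpace.mp hK
  have hemb := (continuousOn_iff_continuous_domRestrict.mp hf).isClosedEmbedding hi.injective
  have hc : Continuous (hg.restrict g s K) :=
    hemb.isInducing.continuous_iff.mpr (continuousOn_iff_continuous_domRestrict.mp hfg)
  exact continuousOn_iff_continuous_domRestrict.mpr (continuous_subtype_val.comp hc)

section RadialExtension

variable {E : Type*} [NormedAddCommGroup E] [NormedSpace ℝ E]

/-- The positively homogeneous (conical) extension of a map on the unit sphere. -/
noncomputable def radialExtension (k : E → E) (v : E) : E := ‖v‖ • k (‖v‖⁻¹ • v)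

theorem inv_norm_smul_mem_unitSphere {v : E} (hv : v ≠ 0) :
    ‖v‖⁻¹ • v ∈ Metric.sphere (0 : E) 1 := by
  simp [norm_smul, hv]

theorem radialExtension_of_mem_sphere (k : E → E) {v : E} (hv : v ∈ Metric.sphere (0 : E) 1) :
    radialExtension k v = k v := by
  have h1 : ‖v‖ = 1 := by simpa using hv
  simp [radialExtension, h1]

theorem norm_radialExtension {k : E → E}
    (hk : Set.MapsTo k (Metric.sphere 0 1) (Metric.sphere 0 1)) (v : E) :
    ‖radialExtension k v‖ = ‖v‖ := by
  rcases eq_or_ne v 0 with rfl | hv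
  · simp [radialExtension]
  · have h1 : ‖k (‖v‖⁻¹ • v)‖ = 1 := by simpa using hk (inv_norm_smul_mem_unitSphere hv)
    simp [radialExtension, norm_smul, h1]

theorem radialExtension_injective {k : E → E}
    (hk : Set.MapsTo k (Metric.sphere 0 1) (Metric.sphere 0 1))
    (hi : Set.InjOn k (Metric.sphere 0 1)) : Function.Injective (radialExtension k) := by
  intro v w hvw
  have hn : ‖v‖ = ‖w‖ := by
    rw [← norm_radialExtension hk v, hvw, norm_radialExtension hk w]
  rcases eq_or_ne v 0 with rfl | hv
  · exact (norm_eq_zero.mp (by simpa using hn.symm)).symm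
  · have hw : w ≠ 0 := by
      rw [← norm_ne_zero_iff, ← hn]
      exact norm_ne_zero_iff.mpr hv
    have hv0 : ‖w‖ ≠ 0 := norm_ne_zero_iff.mpr hw
    have h2 := inv_norm_smul_mem_unitSphere hv
    simp only [radialExtension, hn] at hvw h2
    have h3 := hi h2 (inv_norm_smul_mem_unitSphere hw) (smul_right_injective E hv0 hvw)
    exact smul_right_injective E (inv_ne_zero hv0) h3

theorem continuous_radialExtension {k : E → E}
    (hk : Set.MapsTo k (Metric.sphere 0 1) (Metric.sphere 0 1))
    (hc : ContinuousOn k (Metric.sphere 0 1)) : Continuous (radialExtension k) := by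
  rw [continuous_iff_continuousAt]
  intro v
  rcases eq_or_ne v 0 with rfl | hv
  · have h0 : radialExtension k 0 = 0 := by simp [radialExtension]
    rw [ContinuousAt, h0, tendsto_zero_iff_norm_tendsto_zero]
    simp only [norm_radialExtension hk]
    exact tendsto_norm_zero
  · have hon : ContinuousOn (radialExtension k) {0}ᶜ := by
      refine continuousOn_id.norm.smul (hc.comp ?_ fun w hw => inv_norm_smul_mem_unitSphere hw)
      exact (continuousOn_id.norm.inv₀ fun w hw => norm_ne_zero_iff.mpr hw).smul continuousOn_id
    exact hon.continuousAt (isOpen_compl_singleton.mem_nhds hv)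

end RadialExtension

section EucProd

variable {d : ℕ}

theorem continuous_xpart : Continuous (xpart (d := d)) :=
  continuous_fst.comp (WithLp.prod_continuous_ofLp 2 _ _)

theorem continuous_tpart : Continuous (tpart (d := d)) :=
  continuous_snd.comp (WithLp.prod_continuous_ofLp 2 _ _)

theorem continuous_mkPt :
    Continuous fun p : EuclideanSpace ℝ (Fin d) × ℝ => mkPt p.1 p.2 :=
  WithLp.prod_continuous_toLp 2 _ _

@[simp] theorem xpart_mkPt (x : EuclideanSpace ℝ (Fin d)) (t : ℝ) : xpart (mkPt x t) = x := rfl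

@[simp] theorem tpart_mkPt (x : EuclideanSpace ℝ (Fin d)) (t : ℝ) : tpart (mkPt x t) = t := rfl

theorem mkPt_xpart_tpart (q : EucProd d) : mkPt (xpart q) (tpart q) = q := rfl

theorem mem_sphereD_iff (q : EucProd d) : q ∈ sphereD d ↔ ‖xpart q‖ ^ 2 + tpart q ^ 2 = 1 := by
  have h := WithLp.prod_norm_sq_eq_of_L2 q
  have h2 : ‖xpart q‖ ^ 2 + tpart q ^ 2 = ‖q‖ ^ 2 := by
    rw [h, ← sq_abs (tpart q)]
    rfl
  rw [h2, sphereD, mem_sphere_zero_iff_norm, pow_eq_one_iff_of_nonneg (norm_nonneg q) two_ne_zero]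

theorem isCompact_equatorD : IsCompact (equatorD d) :=
  (isCompact_sphere 0 1).inter_right (isClosed_singleton.preimage continuous_tpart)

theorem xpart_mem_sphere_of_mem_equatorD {q : EucProd d} (hq : q ∈ equatorD d) :
    xpart q ∈ Metric.sphere (0 : EuclideanSpace ℝ (Fin d)) 1 := by
  have h1 := (mem_sphereD_iff q).mp hq.1
  rw [hq.2] at h1
  rw [mem_sphere_zero_iff_norm]
  exact (pow_eq_one_iff_of_nonneg (norm_nonneg _) two_ne_zero).mp (by linarith)

theorem mkPt_zero_of_mem_equatorD {q : EucProd d} (hq : q ∈ equatorD d) :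
    mkPt (xpart q) 0 = q := by
  rw [← hq.2, mkPt_xpart_tpart]

/-- The cone extension of a self-map of the equator to a self-map of the sphere, composed with
the reflection `t ↦ -t` when `σ = -1`. -/
noncomputable def coneExtension (k : EuclideanSpace ℝ (Fin d) → EuclideanSpace ℝ (Fin d))
    (σ : ℝ) (q : EucProd d) : EucProd d :=
  mkPt (radialExtension k (xpart q)) (σ * tpart q)

variable {k : EuclideanSpace ℝ (Fin d) → EuclideanSpace ℝ (Fin d)}

theorem continuous_coneExtension (hk : Set.MapsTo k (Metric.sphere 0 1) (Metric.sphere 0 1))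
    (hc : ContinuousOn k (Metric.sphere 0 1)) (σ : ℝ) : Continuous (coneExtension k σ) :=
  continuous_mkPt.comp (((continuous_radialExtension hk hc).comp continuous_xpart).prodMk
    (continuous_const.mul continuous_tpart))

theorem coneExtension_injective (hk : Set.MapsTo k (Metric.sphere 0 1) (Metric.sphere 0 1))
    (hi : Set.InjOn k (Metric.sphere 0 1)) {σ : ℝ} (hσ : σ ≠ 0) :
    Function.Injective (coneExtension k σ) := by
  intro p q hpq
  have hx : xpart p = xpart q := radialExtension_injective hk hi (congrArg xpart hpq)
  have ht : tpart p = tpart q := mul_left_cancel₀ hσ (congrArg tpart hpq)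
  rw [← mkPt_xpart_tpart p, hx, ht, mkPt_xpart_tpart]

theorem coneExtension_mem_sphereD (hk : Set.MapsTo k (Metric.sphere 0 1) (Metric.sphere 0 1))
    {σ : ℝ} (hσ : σ ^ 2 = 1) {q : EucProd d} (hq : q ∈ sphereD d) :
    coneExtension k σ q ∈ sphereD d := by
  rw [mem_sphereD_iff] at hq ⊢
  simpa [coneExtension, norm_radialExtension hk, mul_pow, hσ] using hq

end EucProd

/-- Schoenflies extension implies homeomorphic extension (Proposition A.4 (i)):
given a homeomorphism `γ : cl(Ω) → H̄` with `γ(∂Ω) = S^{d-1}` (equator), a continuous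
injective `y : S^{d-1} → S^d`, a homeomorphism `δ : S^d → ℝ^d ∪ {∞}` with
`∞ ∉ δ(y(S^{d-1}))`, and a Schoenflies extension `h : S^d → S^d` with
`h(S^{d-1}) = y(S^{d-1})`, the map `ỹ = δ ∘ y ∘ γ : ∂Ω → ℝ^d` admits a homeomorphic
extension to `cl(Ω)`. -/
theorem homeomorphic_extension_of_schoenflies {d : ℕ} (hd : 2 ≤ d)
    (Ω : Set (EuclideanSpace ℝ (Fin d)))
    (hΩo : IsOpen Ω) (hΩconn : IsConnected Ω) (hΩb : Bornology.IsBounded Ω)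
    (γ : EuclideanSpace ℝ (Fin d) → EucProd d)
    (hγc : ContinuousOn γ (closure Ω)) (hγi : Set.InjOn γ (closure Ω))
    (hγim : γ '' (closure Ω) = upperHemiD d)
    (hγeq : γ '' (frontier Ω) = equatorD d)
    (y : EuclideanSpace ℝ (Fin d) → EucProd d)
    (hyc : ContinuousOn y (Metric.sphere (0 : EuclideanSpace ℝ (Fin d)) 1))
    (hyi : Set.InjOn y (Metric.sphere (0 : EuclideanSpace ℝ (Fin d)) 1))
    (hyim : y '' (Metric.sphere (0 : EuclideanSpace ℝ (Fin d)) 1) ⊆ sphereD d)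
    (δ : EucProd d → OnePoint (EuclideanSpace ℝ (Fin d)))
    (hδc : ContinuousOn δ (sphereD d)) (hδi : Set.InjOn δ (sphereD d))
    (hδim : δ '' (sphereD d) = Set.univ)
    (hδfin : ∀ q ∈ y '' (Metric.sphere (0 : EuclideanSpace ℝ (Fin d)) 1),
      δ q ≠ OnePoint.infty)
    (h : EucProd d → EucProd d)
    (hhc : ContinuousOn h (sphereD d)) (hhi : Set.InjOn h (sphereD d))
    (hhim : h '' (sphereD d) = sphereD d)
    (hheq : h '' (equatorD d) = y '' (Metric.sphere (0 : EuclideanSpace ℝ (Fin d)) 1)) :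
    ∃ htil : EuclideanSpace ℝ (Fin d) → EuclideanSpace ℝ (Fin d),
      ContinuousOn htil (closure Ω) ∧ Set.InjOn htil (closure Ω) ∧
      ∀ x ∈ frontier Ω, OnePoint.some (htil x) = δ (y (xpart (γ x))) := by
  have hlift : ∀ v ∈ Metric.sphere (0 : EuclideanSpace ℝ (Fin d)) 1,
      ∃ e ∈ equatorD d, h e = y v := fun v hv =>
    (hheq ▸ Set.mem_image_of_mem y hv : y v ∈ h '' equatorD d)
  choose! e he hey using hlift
  have hec : ContinuousOn e (Metric.sphere 0 1) :=
    ContinuousOn.of_comp_injOn_isCompact isCompact_equatorD (hhc.mono fun q hq => hq.1)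
      (hhi.mono fun q hq => hq.1) he (hyc.congr hey)
  have hkm : Set.MapsTo (fun v => xpart (e v)) (Metric.sphere 0 1) (Metric.sphere 0 1) :=
    fun v hv => xpart_mem_sphere_of_mem_equatorD (he v hv)
  have hkc : ContinuousOn (fun v => xpart (e v)) (Metric.sphere 0 1) :=
    continuous_xpart.comp_continuousOn hec
  have hki : Set.InjOn (fun v => xpart (e v)) (Metric.sphere 0 1) := by
    intro v hv w hw hvw
    apply hyi hv hw
    rw [← hey v hv, ← hey w hw, ← mkPt_zero_of_mem_equatorD (he v hv),
      ← mkPt_zero_of_mem_equatorD (he w hw)]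
    exact congrArg (fun x => h (mkPt x 0)) hvw
  obtain ⟨p, hp, hpinf⟩ : OnePoint.infty ∈ δ '' sphereD d := hδim ▸ Set.mem_univ _
  obtain ⟨q, hq, rfl⟩ : p ∈ h '' sphereD d := hhim.symm ▸ hp
  have hqt : tpart q ≠ 0 := fun h0 =>
    hδfin (h q) (hheq ▸ Set.mem_image_of_mem h ⟨hq, h0⟩) hpinf
  obtain ⟨σ, hσ, hσq⟩ : ∃ σ : ℝ, σ ^ 2 = 1 ∧ σ * tpart q < 0 := by
    rcases lt_or_gt_of_ne hqt with h0 | h0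
    · exact ⟨1, by norm_num, by linarith⟩
    · exact ⟨-1, by norm_num, by linarith⟩
  have hσ0 : σ ≠ 0 := by
    rintro rfl
    norm_num at hσ
  set G := coneExtension (fun v => xpart (e v)) σ
  have hγH : Set.MapsTo γ (closure Ω) (upperHemiD d) :=
    fun x hx => hγim ▸ Set.mem_image_of_mem γ hx
  have hGS : Set.MapsTo (fun x => G (γ x)) (closure Ω) (sphereD d) :=
    fun x hx => coneExtension_mem_sphereD hkm hσ (hγH hx).1
  have hhS : Set.MapsTo h (sphereD d) (sphereD d) :=
    fun x hx => hhim.subset (Set.mem_image_of_mem h hx)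
  have hfin : ∀ x ∈ closure Ω, ∃ z : EuclideanSpace ℝ (Fin d),
      OnePoint.some z = δ (h (G (γ x))) := by
    intro x hx
    refine OnePoint.ne_infty_iff_exists.mp fun hinf => ?_
    have hGq : G (γ x) = q :=
      hhi (hGS hx) hq (hδi (hhS (hGS hx)) (hhS hq) (hinf.trans hpinf.symm))
    have ht : σ * tpart (γ x) = tpart q := congrArg tpart hGq
    have hpos := (hγH hx).2
    rw [← ht, ← mul_assoc, ← pow_two, hσ] at hσq
    linarith
  choose! f hf using hfin
  refine ⟨f, ?_, ?_, ?_⟩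
  · rw [OnePoint.isOpenEmbedding_coe.isInducing.continuousOn_iff]
    refine ContinuousOn.congr ?_ hf
    exact hδc.comp (hhc.comp ((continuous_coneExtension hkm hkc σ).comp_continuousOn hγc) hGS)
      (hhS.comp hGS)
  · intro x hx x' hx' hxx
    have h1 : δ (h (G (γ x))) = δ (h (G (γ x'))) := by rw [← hf x hx, ← hf x' hx', hxx]
    exact hγi hx hx' (coneExtension_injective hkm hki hσ0
      (hhi (hGS hx) (hGS hx') (hδi (hhS (hGS hx)) (hhS (hGS hx')) h1)))
  · intro x hx
    have hxe : γ x ∈ equatorD d := hγeq ▸ Set.mem_image_of_mem γ hx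
    have hxs := xpart_mem_sphere_of_mem_equatorD hxe
    have hG : G (γ x) = e (xpart (γ x)) := by
      simp only [G, coneExtension, radialExtension_of_mem_sphere _ hxs, hxe.2, mul_zero]
      exact mkPt_zero_of_mem_equatorD (he _ hxs)
    rw [hf x (frontier_subset_closure hx), hG, hey _ hxs]
end
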